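/- Let a, b, c be integers with a > c > b > 0. Then in RatFunc ℚ: f_{a-b}·f_a·f_c - f_{a-b}·f_{a-c}·f_c - f_{a-b}·f_b·f_c - f_{a-b}·f_{c-b}·f_c + f_a·f_b·f_c + f_{a-c}·f_{c-b}·f_c = 0. (This is the signed sum of the Atiyah–Singer contributions of the fixed point data {+,a-b,a,c}, {-,a-b,a-c,c}, {-,a-b,b,c}, {-,a-b,c-b,c}, {+,a,b,c}, {+,a-c,c-b,c} of the circle action on the manifold Z₁(a,b,c) of Example 3.5; it is the identity behind Operation (3') of Theorem 1.2.) -/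

import Mathlib

/-- The rational function `(1 + X^w)/(1 - X^w)` in `RatFunc ℚ`, for an integer
exponent `w`. -/
noncomputable def f (w : ℤ) : RatFunc ℚ :=
  (1 + RatFunc.X ^ w) / (1 - RatFunc.X ^ w)

theorem X_zpow_ne (w : ℤ) (hw : 0 < w) : (1 : RatFunc ℚ) - RatFunc.X ^ w ≠ 0 := by
  lift w to ℕ using hw.le
  intro h
  have h1 : (RatFunc.X : RatFunc ℚ) ^ w = 1 := by
    rw [zpow_natCast] at h
    exact (sub_eq_zero.mp h).symm
  rw [← RatFunc.algebraMap_X, ← map_pow, ← map_one (algebraMap (Polynomial ℚ) (RatFunc ℚ))] at h1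
  have h2 := RatFunc.algebraMap_injective ℚ h1
  have h3 := congrArg Polynomial.natDegree h2
  rw [Polynomial.natDegree_X_pow, Polynomial.natDegree_one] at h3
  omega

theorem f_add (u v : ℤ) (hu : 0 < u) (hv : 0 < v) :
    f (u + v) * (f u + f v) = f u * f v + 1 := by
  have h1 := X_zpow_ne u hu
  have h2 := X_zpow_ne v hv
  have h3 := X_zpow_ne (u + v) (by omega)
  unfold f
  rw [zpow_add₀ RatFunc.X_ne_zero] at *
  generalize (RatFunc.X : RatFunc ℚ) ^ u = x at *
  generalize (RatFunc.X : RatFunc ℚ) ^ v = y at *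
  field_simp
  ring

/-- The signed sum of the Atiyah–Singer contributions of the fixed point data
`{+,a-b,a,c}`, `{-,a-b,a-c,c}`, `{-,a-b,b,c}`, `{-,a-b,c-b,c}`, `{+,a,b,c}`,
`{+,a-c,c-b,c}` of the circle action on `Z₁(a,b,c)` (Example 3.5, `a > c > b > 0`)
vanishes; the identity behind Operation (3') of Theorem 1.2. -/
theorem stmt8 (a b c : ℤ) (hac : a > c) (hcb : c > b) (hb : b > 0) :
    f (a - b) * f a * f c - f (a - b) * f (a - c) * f c
      - f (a - b) * f b * f c - f (a - b) * f (c - b) * f c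
      + f a * f b * f c + f (a - c) * f (c - b) * f c = 0 := by
  have h1 := f_add (a - c) (c - b) (by omega) (by omega)
  have h2 := f_add (a - b) b (by omega) hb
  rw [show a - c + (c - b) = a - b by ring] at h1
  rw [show a - b + b = a by ring] at h2
  linear_combination f c * h2 - f c * h1
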